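/- For every fixed α < 0 there exist constants 0 < c ≤ C < ∞ such that for every ε ∈ (0,1), c · ε^{(1/2)+2|α|} exp(−1/(4 ε^{2|α|})) ≤ ∫₀^ε p_{2s}(ε^{(1/2)+α}) ds ≤ C · ε^{(1/2)+2|α|} exp(−1/(4 ε^{2|α|})). (Equivalently, the covariance of the solution of the constant-coefficient stochastic heat equation at time ε between spatial points 0 and ε^{(1/2)+α} is of sharp order ε^{(1/2)+2|α|} exp(−1/(4 ε^{2|α|})) uniformly for ε ∈ (0,1) when α < 0.) -/

import Mathlib

open MeasureTheory Real

/-- The heat kernel on ℝ: `p r w = (2πr)^{-1/2} exp(-w²/(2r))`. -/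
noncomputable def heatKernel (r w : ℝ) : ℝ :=
  (2 * Real.pi * r) ^ (-(1 : ℝ) / 2) * Real.exp (-w ^ 2 / (2 * r))

/-- An antiderivative in `s` of `(3/2 * s + w² / 4)` times the heat kernel at time `2s`. -/
noncomputable def heatPrimitive (w s : ℝ) : ℝ :=
  (4 * π) ^ (-(1 : ℝ) / 2) * (s ^ ((3 : ℝ) / 2) * exp (-w ^ 2 / (4 * s)))

lemma heatKernel_two_mul {s : ℝ} (hs : 0 < s) (w : ℝ) :
    heatKernel (2 * s) w =
      (4 * π) ^ (-(1 : ℝ) / 2) * (s ^ (-(1 : ℝ) / 2) * exp (-w ^ 2 / (4 * s))) := by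
  rw [heatKernel, show 2 * π * (2 * s) = (4 * π) * s by ring,
    mul_rpow (by positivity) hs.le, show 2 * (2 * s) = 4 * s by ring, mul_assoc]

lemma hasDerivAt_heatPrimitive {s : ℝ} (hs : 0 < s) (w : ℝ) :
    HasDerivAt (heatPrimitive w) ((3 / 2 * s + w ^ 2 / 4) * heatKernel (2 * s) w) s := by
  have h1 : HasDerivAt (fun s : ℝ => s ^ ((3 : ℝ) / 2)) ((3 : ℝ) / 2 * s ^ ((3 : ℝ) / 2 - 1)) s :=
    hasDerivAt_rpow_const (Or.inl hs.ne')
  have h2 : HasDerivAt (fun s : ℝ => -w ^ 2 / (4 * s)) (w ^ 2 / (4 * s ^ 2)) s := by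
    have h := ((hasDerivAt_id' s).const_mul (4 : ℝ)).fun_inv (by simp [hs.ne'])
    refine (h.const_mul (-w ^ 2)).congr_deriv ?_
    field_simp
  refine ((h1.mul h2.exp).const_mul ((4 * π) ^ (-(1 : ℝ) / 2))).congr_deriv ?_
  rw [heatKernel_two_mul hs]
  have e1 : s ^ ((3 : ℝ) / 2 - 1) = s * s ^ (-(1 : ℝ) / 2) := by
    rw [show (3 : ℝ) / 2 - 1 = 1 + -(1 : ℝ) / 2 by norm_num, rpow_add hs, rpow_one]
  have e2 : s ^ ((3 : ℝ) / 2) = s ^ 2 * s ^ (-(1 : ℝ) / 2) := by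
    rw [show (3 : ℝ) / 2 = 2 + -(1 : ℝ) / 2 by norm_num, rpow_add hs, rpow_two]
  rw [e1, e2]
  field_simp

lemma continuousWithinAt_heatPrimitive_zero (w : ℝ) :
    ContinuousWithinAt (heatPrimitive w) (Set.Ici 0) 0 := by
  have h0 : heatPrimitive w 0 = 0 := by simp [heatPrimitive]
  rw [ContinuousWithinAt, h0]
  have h1 : Filter.Tendsto (fun s : ℝ => (4 * π) ^ (-(1 : ℝ) / 2) * s ^ ((3 : ℝ) / 2))
      (nhdsWithin 0 (Set.Ici 0)) (nhds 0) := by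
    have h : Continuous (fun s : ℝ => (4 * π) ^ (-(1 : ℝ) / 2) * s ^ ((3 : ℝ) / 2)) :=
      continuous_const.mul (continuous_rpow_const (by norm_num))
    simpa using (h.tendsto 0).mono_left nhdsWithin_le_nhds
  refine squeeze_zero' ?_ ?_ h1
  · filter_upwards [self_mem_nhdsWithin] with s hs
    have : 0 ≤ s := hs
    unfold heatPrimitive
    positivity
  · filter_upwards [self_mem_nhdsWithin] with s hs
    have hs : 0 ≤ s := hs
    have hexp : exp (-w ^ 2 / (4 * s)) ≤ 1 :=
      exp_le_one_iff.2 (div_nonpos_of_nonpos_of_nonneg (by nlinarith) (by positivity))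
    unfold heatPrimitive
    gcongr
    exact mul_le_of_le_one_right (by positivity) hexp

lemma continuousOn_heatPrimitive (w ε : ℝ) :
    ContinuousOn (heatPrimitive w) (Set.Icc 0 ε) := by
  intro s hs
  rcases hs.1.eq_or_lt with rfl | h
  · exact (continuousWithinAt_heatPrimitive_zero w).mono Set.Icc_subset_Ici_self
  · exact (hasDerivAt_heatPrimitive h w).continuousAt.continuousWithinAt

lemma heatKernel_nonneg {r : ℝ} (hr : 0 ≤ r) (w : ℝ) : 0 ≤ heatKernel r w := by
  unfold heatKernel
  positivity

/-- Two-sided bound on the time integral of the heat kernel in the off-diagonal regime. -/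
lemma integral_heatKernel_bounds {w ε : ℝ} (hε : 0 < ε) (hw : ε ≤ w ^ 2) :
    w ^ 2 / 4 * (∫ s in (0 : ℝ)..ε, heatKernel (2 * s) w) ≤ heatPrimitive w ε ∧
      heatPrimitive w ε ≤ 7 / 4 * w ^ 2 * ∫ s in (0 : ℝ)..ε, heatKernel (2 * s) w := by
  have hw0 : 0 < w ^ 2 := hε.trans_le hw
  have hk : ∀ s ∈ Set.Ioo 0 ε, 0 ≤ heatKernel (2 * s) w := fun s hs =>
    heatKernel_nonneg (by linarith [hs.1]) w
  have hderiv : ∀ s ∈ Set.Ioo 0 ε, HasDerivAt (heatPrimitive w)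
      ((3 / 2 * s + w ^ 2 / 4) * heatKernel (2 * s) w) s := fun s hs =>
    hasDerivAt_heatPrimitive hs.1 w
  have hint : IntervalIntegrable
      (fun s => (3 / 2 * s + w ^ 2 / 4) * heatKernel (2 * s) w) volume 0 ε := by
    rw [intervalIntegrable_iff_integrableOn_Ioc_of_le hε.le]
    refine intervalIntegral.integrableOn_deriv_of_nonneg (continuousOn_heatPrimitive w ε)
      hderiv fun s hs => mul_nonneg ?_ (hk s hs)
    linarith [hs.1]
  have hker : IntervalIntegrable (fun s => heatKernel (2 * s) w) volume 0 ε := by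
    rw [intervalIntegrable_iff_integrableOn_Ioo_of_le hε.le] at hint ⊢
    refine (hint.const_mul (4 / w ^ 2)).mono' ?_ ?_
    · unfold heatKernel
      fun_prop
    · filter_upwards [ae_restrict_mem measurableSet_Ioo] with s hs
      rw [norm_of_nonneg (hk s hs), ← mul_assoc]
      refine le_mul_of_one_le_left (hk s hs) ?_
      rw [div_mul_eq_mul_div, le_div_iff₀ hw0]
      linarith [hs.1]
  have hFTC := intervalIntegral.integral_eq_sub_of_hasDerivAt_of_le hε.le
    (continuousOn_heatPrimitive w ε) hderiv hint
  have h0 : heatPrimitive w 0 = 0 := by simp [heatPrimitive]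
  rw [h0, sub_zero] at hFTC
  rw [← hFTC, ← intervalIntegral.integral_const_mul, ← intervalIntegral.integral_const_mul]
  constructor
  · refine intervalIntegral.integral_mono_on_of_le_Ioo hε.le (hker.const_mul _) hint fun s hs => ?_
    exact mul_le_mul_of_nonneg_right (by linarith [hs.1]) (hk s hs)
  · refine intervalIntegral.integral_mono_on_of_le_Ioo hε.le hint (hker.const_mul _) fun s hs => ?_
    exact mul_le_mul_of_nonneg_right (by linarith [hs.2]) (hk s hs)

lemma heatPrimitive_rpow {ε : ℝ} (hε : 0 < ε) (a : ℝ) :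
    heatPrimitive (ε ^ ((1 : ℝ) / 2 - a)) ε =
      (ε ^ ((1 : ℝ) / 2 - a)) ^ 2 * ((4 * π) ^ (-(1 : ℝ) / 2) * ε ^ ((1 : ℝ) / 2 + 2 * a) *
        exp (-1 / (4 * ε ^ (2 * a)))) := by
  have h1 : (ε ^ ((1 : ℝ) / 2 - a)) ^ 2 = ε ^ (1 - 2 * a) := by
    rw [← rpow_mul_natCast hε.le]
    congr 1
    push_cast
    ring
  have h2 : -ε ^ (1 - 2 * a) / (4 * ε) = -1 / (4 * ε ^ (2 * a)) := by
    rw [rpow_sub hε, rpow_one]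
    field_simp
  have h3 : ε ^ ((3 : ℝ) / 2) = ε ^ (1 - 2 * a) * ε ^ ((1 : ℝ) / 2 + 2 * a) := by
    rw [← rpow_add hε]
    congr 1
    ring
  rw [heatPrimitive, h1, h2, h3]
  ring

/-- For fixed `α < 0`, the covariance `∫₀^ε p_{2s}(ε^{1/2+α}) ds` of the
constant-coefficient stochastic heat equation is of sharp order
`ε^{1/2+2|α|} exp(−1/(4 ε^{2|α|}))`, uniformly for `ε ∈ (0,1)`. -/
theorem covariance_order_alpha_neg (α : ℝ) (hα : α < 0) :
    ∃ c C : ℝ, 0 < c ∧ c ≤ C ∧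
      ∀ ε ∈ Set.Ioo (0 : ℝ) 1,
        c * ε ^ ((1 : ℝ) / 2 + 2 * |α|) * Real.exp (-1 / (4 * ε ^ (2 * |α|))) ≤
            (∫ s in (0 : ℝ)..ε, heatKernel (2 * s) (ε ^ ((1 : ℝ) / 2 + α))) ∧
          (∫ s in (0 : ℝ)..ε, heatKernel (2 * s) (ε ^ ((1 : ℝ) / 2 + α))) ≤
            C * ε ^ ((1 : ℝ) / 2 + 2 * |α|) * Real.exp (-1 / (4 * ε ^ (2 * |α|))) := by
  refine ⟨4 / 7 * (4 * π) ^ (-(1 : ℝ) / 2), 4 * (4 * π) ^ (-(1 : ℝ) / 2), by positivity,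
    by gcongr; norm_num, fun ε hε => ?_⟩
  obtain ⟨hε0, hε1⟩ := hε
  have hα' : (1 : ℝ) / 2 + α = 1 / 2 - |α| := by rw [abs_of_neg hα]; ring
  rw [hα']
  have hw : ε ≤ (ε ^ ((1 : ℝ) / 2 - |α|)) ^ 2 := by
    rw [← rpow_mul_natCast hε0.le]
    refine self_le_rpow_of_le_one hε0.le hε1.le ?_
    push_cast
    linarith [abs_nonneg α]
  obtain ⟨hlow, hup⟩ := integral_heatKernel_bounds hε0 hw
  rw [heatPrimitive_rpow hε0] at hlow hup
  have hw0 : 0 < (ε ^ ((1 : ℝ) / 2 - |α|)) ^ 2 := hε0.trans_le hw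
  constructor
  · refine le_of_mul_le_mul_left ?_ hw0
    linarith
  · refine le_of_mul_le_mul_left ?_ hw0
    linarith
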